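/- arXiv:1403.6016 — 2 statements merged into one kernel-verified Lean document; each statement's English description precedes it below -/
import Mathlib

section
/- The Dirichlet D-norm is pointwise decreasing in its parameter: for every x ∈ R^d and 0 < α_1 ≤ α_2, one has (1/α_1) E(max_i |x_i| V_i^{(α_1)}) ≥ (1/α_2) E(max_i |x_i| V_i^{(α_2)}), where V_1^{(α)},...,V_d^{(α)} are i.i.d. Gamma(α). -/
open MeasureTheory ProbabilityTheory

/-- The Dirichlet D-norm `‖x‖_{D(α)} = (1/α) E(max_i |xᵢ| Vᵢ)`, with
`V₁,...,V_d` i.i.d. Gamma(α), realized on the product measure. -/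
noncomputable def dirichletDNorm (d : ℕ) (α : ℝ) (x : Fin d → ℝ) : ℝ :=
  (1 / α) * ∫ v : Fin d → ℝ, ⨆ i, |x i| * v i
    ∂(Measure.pi fun _ => gammaMeasure α 1)

@[fun_prop]
lemma measurable_gammaPDF (a r : ℝ) : Measurable (gammaPDF a r) :=
  (measurable_gammaPDFReal a r).ennreal_ofReal

@[fun_prop]
lemma measurable_betaPDF (a c : ℝ) : Measurable (betaPDF a c) :=
  (measurable_betaPDFReal a c).ennreal_ofReal

lemma gammaPDFReal_of_neg {a r x : ℝ} (hx : x < 0) : gammaPDFReal a r x = 0 := by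
  simp [gammaPDFReal, hx.not_ge]

/-- Change of variables relating the joint density of a gamma and a beta variable to the joint
density of two gamma variables. -/
lemma gammaPDFReal_mul_betaPDFReal_div {a c v w : ℝ} (ha : 0 < a) (hc : 0 < c) (hv : v ≠ 0)
    (hw : w ≠ v) :
    gammaPDFReal (a + c) 1 w * (w⁻¹ * betaPDFReal a c (w⁻¹ * v)) =
      gammaPDFReal a 1 v * gammaPDFReal c 1 (w - v) := by
  rcases lt_or_ge 0 w with hw0 | hw0
  · by_cases h : 0 < v ∧ v < w
    · obtain ⟨hv0, hvw⟩ := h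
      have h1 : 0 < w⁻¹ * v ∧ w⁻¹ * v < 1 :=
        ⟨by positivity, by rwa [inv_mul_lt_one₀ hw0]⟩
      have hwv : 0 < w - v := sub_pos.2 hvw
      have e1 : 1 - w⁻¹ * v = w⁻¹ * (w - v) := by field_simp
      have hΓ := (Real.Gamma_pos_of_pos ha).ne'
      have hΓc := (Real.Gamma_pos_of_pos hc).ne'
      have hΓs := (Real.Gamma_pos_of_pos (add_pos ha hc)).ne'
      have e2 : w ^ (a + c - 1) * (w⁻¹ * (w⁻¹ ^ (a - 1) * w⁻¹ ^ (c - 1))) = 1 := by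
        have : w⁻¹ * (w⁻¹ ^ (a - 1) * w⁻¹ ^ (c - 1)) = w⁻¹ ^ (a + c - 1) := by
          rw [show a + c - 1 = 1 + ((a - 1) + (c - 1)) by ring, Real.rpow_add (by positivity) 1,
            Real.rpow_one, Real.rpow_add (by positivity)]
        rw [this, ← Real.mul_rpow hw0.le (by positivity), mul_inv_cancel₀ hw0.ne', Real.one_rpow]
      have e3 : Real.exp (-w) = Real.exp (-v) * Real.exp (-(w - v)) := by
        rw [← Real.exp_add]; congr 1; ring
      simp only [gammaPDFReal, betaPDFReal, if_pos h1, if_pos hw0.le, if_pos hv0.le,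
        if_pos hwv.le, beta, Real.one_rpow, one_mul, e1, e3]
      rw [Real.mul_rpow (by positivity) hv0.le, Real.mul_rpow (by positivity) hwv.le]
      generalize w ^ (a + c - 1) = p at *
      generalize w⁻¹ ^ (a - 1) = q at *
      generalize w⁻¹ ^ (c - 1) = r at *
      generalize w⁻¹ = u at *
      field_simp
      linear_combination e2
    · have hr : betaPDFReal a c (w⁻¹ * v) = 0 := by
        rw [betaPDFReal, if_neg]
        rintro ⟨h1, h2⟩
        refine h ⟨(pos_iff_pos_of_mul_pos h1).1 (by positivity), ?_⟩
        rwa [inv_mul_lt_one₀ hw0] at h2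
      rw [hr]
      rcases hv.lt_or_gt with hv0 | hv0
      · simp [gammaPDFReal_of_neg hv0]
      · have : w - v < 0 := by
          rcases hw.lt_or_gt with h' | h'
          · linarith
          · exact absurd ⟨hv0, h'⟩ h
        simp [gammaPDFReal_of_neg this]
  · have hl : gammaPDFReal (a + c) 1 w * w⁻¹ = 0 := by
      rcases hw0.lt_or_eq with h | h
      · simp [gammaPDFReal_of_neg h]
      · simp [h]
    rw [← mul_assoc, hl, zero_mul]
    rcases hv.lt_or_gt with hv0 | hv0
    · simp [gammaPDFReal_of_neg hv0]
    · simp [gammaPDFReal_of_neg (show w - v < 0 by linarith)]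

lemma betaPDFReal_nonneg {a c : ℝ} (ha : 0 < a) (hc : 0 < c) (x : ℝ) :
    0 ≤ betaPDFReal a c x := by
  by_cases h : 0 < x ∧ x < 1
  · exact (betaPDFReal_pos h.1 h.2 ha hc).le
  · simp [betaPDFReal, h]

lemma lintegral_eq_mul_lintegral_inv_mul {w : ℝ} (hw : 0 < w) {g : ℝ → ENNReal}
    (hg : Measurable g) :
    ∫⁻ b, g b = ENNReal.ofReal w⁻¹ * ∫⁻ v, g (w⁻¹ * v) := by
  have h := Real.smul_map_volume_mul_left (inv_ne_zero hw.ne')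
  rw [abs_of_pos (inv_pos.2 hw)] at h
  conv_lhs => rw [← h]
  rw [lintegral_smul_measure, lintegral_map hg (by fun_prop), smul_eq_mul]

/-- The product of independent `Gamma(a + c)` and `Beta(a, c)` variables is `Gamma(a)`. -/
lemma map_mul_gammaMeasure_prod_betaMeasure {a c : ℝ} (ha : 0 < a) (hc : 0 < c) :
    ((gammaMeasure (a + c) 1).prod (betaMeasure a c)).map (fun p => p.1 * p.2) =
      gammaMeasure a 1 := by
  have := isProbabilityMeasure_gammaMeasure (add_pos ha hc) one_pos
  have := isProbabilityMeasureBeta ha hc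
  refine Measure.ext_of_lintegral _ fun f hf => ?_
  rw [lintegral_map hf (by fun_prop), lintegral_prod _ (by fun_prop)]
  unfold gammaMeasure betaMeasure
  have hinner (w : ℝ) : ∫⁻ b, f (w * b) ∂(volume.withDensity (betaPDF a c)) =
      ∫⁻ b, betaPDF a c b * f (w * b) := by
    rw [lintegral_withDensity_eq_lintegral_mul _ (by fun_prop) (by fun_prop)]; rfl
  have hmeas : Measurable fun w => ∫⁻ b, betaPDF a c b * f (w * b) :=
    Measurable.lintegral_prod_right' (f := fun p : ℝ × ℝ => betaPDF a c p.2 * f (p.1 * p.2))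
      (by fun_prop)
  simp_rw [hinner]
  rw [lintegral_withDensity_eq_lintegral_mul _ (by fun_prop) hmeas,
    lintegral_withDensity_eq_lintegral_mul _ (by fun_prop) hf]
  simp only [Pi.mul_apply]
  calc ∫⁻ w, gammaPDF (a + c) 1 w * ∫⁻ b, betaPDF a c b * f (w * b)
      = ∫⁻ w, ∫⁻ v, gammaPDF (a + c) 1 w *
          (ENNReal.ofReal w⁻¹ * betaPDF a c (w⁻¹ * v)) * f v := by
        refine lintegral_congr_ae ?_
        filter_upwards [compl_mem_ae_iff.2 (measure_singleton (0 : ℝ))] with w hw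
        rcases lt_or_gt_of_ne (show w ≠ 0 from hw) with h | h
        · simp [gammaPDF_of_neg h]
        · rw [lintegral_eq_mul_lintegral_inv_mul h (by fun_prop),
            ← lintegral_const_mul _ (by fun_prop), ← lintegral_const_mul _ (by fun_prop)]
          refine lintegral_congr fun v => ?_
          rw [mul_inv_cancel_left₀ h.ne']
          ring
    _ = ∫⁻ v, ∫⁻ w, gammaPDF (a + c) 1 w *
          (ENNReal.ofReal w⁻¹ * betaPDF a c (w⁻¹ * v)) * f v :=
        lintegral_lintegral_swap (by fun_prop)
    _ = ∫⁻ v, ∫⁻ w, gammaPDF a 1 v * f v * gammaPDF c 1 (w - v) := by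
        refine lintegral_congr_ae ?_
        filter_upwards [compl_mem_ae_iff.2 (measure_singleton (0 : ℝ))] with v hv
        refine lintegral_congr_ae ?_
        filter_upwards [compl_mem_ae_iff.2 (measure_singleton v)] with w hw
        have key : gammaPDF (a + c) 1 w * (ENNReal.ofReal w⁻¹ * betaPDF a c (w⁻¹ * v)) =
            gammaPDF a 1 v * gammaPDF c 1 (w - v) := by
          unfold gammaPDF betaPDF
          rw [← ENNReal.ofReal_mul' (betaPDFReal_nonneg ha hc _),
            ← ENNReal.ofReal_mul (gammaPDFReal_nonneg (add_pos ha hc) one_pos _),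
            ← ENNReal.ofReal_mul (gammaPDFReal_nonneg ha one_pos _),
            gammaPDFReal_mul_betaPDFReal_div ha hc hv hw]
        rw [key]
        ring
    _ = ∫⁻ v, gammaPDF a 1 v * f v := by
        refine lintegral_congr fun v => ?_
        rw [lintegral_const_mul _ (by fun_prop),
          lintegral_sub_right_eq_self (fun w => gammaPDF c 1 w) v,
          lintegral_gammaPDF_eq_one hc one_pos, mul_one]

lemma mul_gammaPDFReal {a : ℝ} (ha : 0 < a) (x : ℝ) :
    gammaPDFReal a 1 x * x = a * gammaPDFReal (a + 1) 1 x := by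
  rcases lt_trichotomy x 0 with h | rfl | h
  · simp [gammaPDFReal_of_neg h]
  · simp [gammaPDFReal, Real.zero_rpow ha.ne']
  · have hΓ := (Real.Gamma_pos_of_pos ha).ne'
    simp only [gammaPDFReal, if_pos h.le, Real.one_rpow, Real.Gamma_add_one ha.ne']
    rw [show a + 1 - 1 = (a - 1) + 1 by ring, Real.rpow_add_one h.ne']
    field_simp

lemma mul_betaPDFReal {a c : ℝ} (ha : 0 < a) (hc : 0 < c) (x : ℝ) :
    betaPDFReal a c x * x = a / (a + c) * betaPDFReal (a + 1) c x := by
  by_cases h : 0 < x ∧ x < 1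
  · have hΓ := (Real.Gamma_pos_of_pos ha).ne'
    have hΓc := (Real.Gamma_pos_of_pos hc).ne'
    have hac := add_pos ha hc
    have hΓs := (Real.Gamma_pos_of_pos hac).ne'
    simp only [betaPDFReal, if_pos h, beta, Real.Gamma_add_one ha.ne',
      show a + 1 + c = (a + c) + 1 by ring, Real.Gamma_add_one hac.ne']
    rw [show a + 1 - 1 = (a - 1) + 1 by ring, Real.rpow_add_one h.1.ne']
    field_simp
  · simp [betaPDFReal, h]

lemma integrable_gammaPDFReal {a : ℝ} (ha : 0 < a) : Integrable (gammaPDFReal a 1) := by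
  refine ⟨by fun_prop, ?_⟩
  rw [hasFiniteIntegral_iff_ofReal (.of_forall (gammaPDFReal_nonneg ha one_pos))]
  exact (lintegral_gammaPDF_eq_one ha one_pos).trans_lt ENNReal.one_lt_top

lemma integrable_betaPDFReal {a c : ℝ} (ha : 0 < a) (hc : 0 < c) :
    Integrable (betaPDFReal a c) := by
  refine ⟨by fun_prop, ?_⟩
  rw [hasFiniteIntegral_iff_ofReal (.of_forall (betaPDFReal_nonneg ha hc))]
  exact (lintegral_betaPDF_eq_one ha hc).trans_lt ENNReal.one_lt_top

lemma integral_betaPDFReal {a c : ℝ} (ha : 0 < a) (hc : 0 < c) :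
    ∫ x, betaPDFReal a c x = 1 := by
  rw [integral_eq_lintegral_of_nonneg_ae (.of_forall (betaPDFReal_nonneg ha hc)) (by fun_prop)]
  exact (congrArg ENNReal.toReal (lintegral_betaPDF_eq_one ha hc)).trans ENNReal.toReal_one

lemma integrable_id_gammaMeasure {a : ℝ} (ha : 0 < a) :
    Integrable (fun x => x) (gammaMeasure a 1) := by
  unfold gammaMeasure
  rw [integrable_withDensity_iff_integrable_smul' (measurable_gammaPDF a 1)
    (.of_forall fun _ => ENNReal.ofReal_lt_top)]
  simp only [gammaPDF, ENNReal.toReal_ofReal (gammaPDFReal_nonneg ha one_pos _), smul_eq_mul,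
    mul_gammaPDFReal ha]
  exact (integrable_gammaPDFReal (by positivity)).const_mul a

lemma integrable_id_betaMeasure {a c : ℝ} (ha : 0 < a) (hc : 0 < c) :
    Integrable (fun x => x) (betaMeasure a c) := by
  unfold betaMeasure
  rw [integrable_withDensity_iff_integrable_smul' (measurable_betaPDF a c)
    (.of_forall fun _ => ENNReal.ofReal_lt_top)]
  simp only [betaPDF, ENNReal.toReal_ofReal (betaPDFReal_nonneg ha hc _), smul_eq_mul,
    mul_betaPDFReal ha hc]
  exact (integrable_betaPDFReal (by positivity) hc).const_mul _

lemma integral_id_betaMeasure {a c : ℝ} (ha : 0 < a) (hc : 0 < c) :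
    ∫ x, x ∂(betaMeasure a c) = a / (a + c) := by
  unfold betaMeasure
  rw [integral_withDensity_eq_integral_toReal_smul (measurable_betaPDF a c)
    (.of_forall fun _ => ENNReal.ofReal_lt_top)]
  simp only [betaPDF, ENNReal.toReal_ofReal (betaPDFReal_nonneg ha hc _), smul_eq_mul,
    mul_betaPDFReal ha hc]
  rw [integral_const_mul, integral_betaPDFReal (by positivity) hc, mul_one]

section Pi

variable {ι : Type*} [Fintype ι]

lemma measurable_iSup_mul (y : ι → ℝ) : Measurable fun v : ι → ℝ => ⨆ i, y i * v i :=
  Measurable.iSup fun i => by fun_prop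

variable [Nonempty ι]

lemma integrable_iSup_mul {ρ : Measure ℝ} [IsProbabilityMeasure ρ]
    (hρ : Integrable (fun x => x) ρ) (y : ι → ℝ) :
    Integrable (fun v : ι → ℝ => ⨆ i, y i * v i) (Measure.pi fun _ => ρ) := by
  have hi (i : ι) : Integrable (fun v : ι → ℝ => |y i * v i|) (Measure.pi fun _ => ρ) :=
    (((measurePreserving_eval (fun _ : ι => ρ) i).integrable_comp_of_integrable hρ).const_mul
      (y i)).abs
  refine (integrable_finsetSum Finset.univ fun i _ => hi i).mono'
    (measurable_iSup_mul y).aestronglyMeasurable (.of_forall fun v => ?_)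
  obtain ⟨j, hj⟩ := exists_eq_ciSup_of_finite (f := fun i => y i * v i)
  rw [Real.norm_eq_abs, ← hj]
  exact Finset.single_le_sum (f := fun i => |y i * v i|) (fun i _ => abs_nonneg _)
    (Finset.mem_univ j)

/-- Jensen's inequality for the maximum of finitely many linear forms. -/
lemma integral_mul_iSup_le_integral_iSup_mul {ρ : Measure ℝ} [IsProbabilityMeasure ρ]
    (hρ : Integrable (fun x => x) ρ) (y : ι → ℝ) :
    (∫ x, x ∂ρ) * ⨆ i, y i ≤ ∫ v : ι → ℝ, ⨆ i, y i * v i ∂(Measure.pi fun _ => ρ) := by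
  obtain ⟨j, hj⟩ := exists_eq_ciSup_of_finite (f := y)
  calc (∫ x, x ∂ρ) * ⨆ i, y i = ∫ v : ι → ℝ, y j * v j ∂(Measure.pi fun _ => ρ) := by
        rw [integral_const_mul, integral_comp_eval (μ := fun _ : ι => ρ) (i := j)
          hρ.aestronglyMeasurable, hj, mul_comm]
    _ ≤ _ := integral_mono ((integrable_comp_eval (μ := fun _ : ι => ρ) hρ).const_mul _)
        (integrable_iSup_mul hρ y) fun v =>
          le_ciSup (f := fun i => y i * v i) (Set.finite_range _).bddAbove j

/-- Multiplying the coordinates by i.i.d. factors of mean `m` scales the expected maximum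
by at least `m`. -/
lemma integral_mul_integral_iSup_le {μ ρ : Measure ℝ} [IsProbabilityMeasure μ]
    [IsProbabilityMeasure ρ] (hμ : Integrable (fun x => x) μ) (hρ : Integrable (fun x => x) ρ)
    (y : ι → ℝ) :
    (∫ x, x ∂ρ) * ∫ v : ι → ℝ, ⨆ i, y i * v i ∂(Measure.pi fun _ => μ) ≤
      ∫ v : ι → ℝ, ⨆ i, y i * v i
        ∂(Measure.pi fun _ => (μ.prod ρ).map fun p => p.1 * p.2) := by
  have hmul : Measurable fun p : ℝ × ℝ => p.1 * p.2 := by fun_prop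
  have hprob : IsProbabilityMeasure ((μ.prod ρ).map fun p => p.1 * p.2) :=
    Measure.isProbabilityMeasure_map hmul.aemeasurable
  have hint : Integrable (fun x => x) ((μ.prod ρ).map fun p => p.1 * p.2) :=
    (integrable_map_measure measurable_id.aestronglyMeasurable hmul.aemeasurable).2
      (hμ.mul_prod hρ)
  let e := MeasurableEquiv.arrowProdEquivProdArrow ℝ ℝ ι
  have he : MeasurePreserving e.symm ((Measure.pi fun _ => μ).prod (Measure.pi fun _ => ρ))
      (Measure.pi fun _ => μ.prod ρ) :=
    (measurePreserving_arrowProdEquivProdArrow ℝ ℝ ι (fun _ => μ) (fun _ => ρ)).symm e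
  have hpi : MeasurePreserving (fun (q : ι → ℝ × ℝ) i => (q i).1 * (q i).2)
      (Measure.pi fun _ => μ.prod ρ)
      (Measure.pi fun _ => (μ.prod ρ).map fun p => p.1 * p.2) :=
    ⟨by fun_prop, Measure.pi_map_pi fun _ => hmul.aemeasurable⟩
  have hT := hpi.comp he
  have hF := integrable_iSup_mul (ι := ι) hint y
  have hFT : Integrable (fun p : (ι → ℝ) × (ι → ℝ) => ⨆ i, y i * (p.1 i * p.2 i))
      ((Measure.pi fun _ => μ).prod (Measure.pi fun _ => ρ)) :=
    hT.integrable_comp_of_integrable hF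
  rw [← hT.map_eq, integral_map hT.measurable.aemeasurable
    (measurable_iSup_mul y).aestronglyMeasurable, ← integral_const_mul]
  refine le_of_le_of_eq ?_ (integral_prod _ hFT).symm
  refine integral_mono ((integrable_iSup_mul hμ y).const_mul _) hFT.integral_prod_left
    fun w => ?_
  refine (integral_mul_iSup_le_integral_iSup_mul hρ fun i => y i * w i).trans_eq ?_
  simp only [mul_assoc]

end Pi

/-- The Dirichlet D-norm is pointwise decreasing in its parameter. -/
theorem dirichletDNorm_antitone (d : ℕ) (hd : 0 < d) (x : Fin d → ℝ)
    (α₁ α₂ : ℝ) (hα₁ : 0 < α₁) (h : α₁ ≤ α₂) :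
    dirichletDNorm d α₂ x ≤ dirichletDNorm d α₁ x := by
  rcases h.eq_or_lt with rfl | h
  · exact le_rfl
  obtain ⟨c, hc, rfl⟩ : ∃ c, 0 < c ∧ α₂ = α₁ + c := ⟨α₂ - α₁, sub_pos.2 h, by ring⟩
  have : Nonempty (Fin d) := ⟨⟨0, hd⟩⟩
  have hα₂ := add_pos hα₁ hc
  have := isProbabilityMeasure_gammaMeasure hα₂ one_pos
  have := isProbabilityMeasureBeta hα₁ hc
  have key := integral_mul_integral_iSup_le (integrable_id_gammaMeasure hα₂)
    (integrable_id_betaMeasure hα₁ hc) fun i => |x i|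
  rw [map_mul_gammaMeasure_prod_betaMeasure hα₁ hc, integral_id_betaMeasure hα₁ hc] at key
  unfold dirichletDNorm
  refine le_trans (le_of_eq ?_) (mul_le_mul_of_nonneg_left key (one_div_pos.2 hα₁).le)
  field_simp
end

section
/- For every x ∈ R^d and 0 < α_1 < α_2, the Dirichlet D-norms satisfy α_1 ||x||_{D(α_1)} ≤ α_2 ||x||_{D(α_2)} ≤ α_1 ||x||_{D(α_1)} + (α_2 − α_1) ||x||_{D(α_2−α_1)}. -/
open MeasureTheory ProbabilityTheory

namespace MeasureTheory.Measure

theorem conv_pi {ι M : Type*} [Fintype ι] [AddMonoid M] [MeasurableSpace M] [MeasurableAdd₂ M]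
    (μ ν : ι → Measure M) [∀ i, IsFiniteMeasure (μ i)] [∀ i, IsFiniteMeasure (ν i)] :
    Measure.pi μ ∗ Measure.pi ν = Measure.pi fun i => μ i ∗ ν i := by
  have hmap := (measurePreserving_arrowProdEquivProdArrow M M ι μ ν).map_eq
  rw [Measure.conv, ← hmap, Measure.map_map (by fun_prop) (MeasurableEquiv.measurable _)]
  exact pi_map_pi (μ := fun i => (μ i).prod (ν i)) (f := fun _ (p : M × M) => p.1 + p.2)
    fun i => by fun_prop

end MeasureTheory.Measure

namespace ProbabilityTheory

open Measure

@[fun_prop]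
theorem measurable_gammaPDF (a r : ℝ) : Measurable (gammaPDF a r) :=
  (measurable_gammaPDFReal a r).ennreal_ofReal

theorem gammaPDFReal_mul_gammaPDFReal_sub {a b r x u : ℝ} (ha : 0 < a) (hb : 0 < b) (hr : 0 < r)
    (hx : 0 < x) (hu0 : u ≠ 0) (hu1 : u ≠ 1) :
    x * (gammaPDFReal a r (x * u) * gammaPDFReal b r (x - x * u)) =
      gammaPDFReal (a + b) r x * betaPDFReal a b u := by
  have hxu : x - x * u = x * (1 - u) := by ring
  rcases lt_or_gt_of_ne hu0 with h0 | h0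
  · simp [gammaPDFReal, betaPDFReal, (mul_neg_of_pos_of_neg hx h0).not_ge, h0.not_gt]
  rcases lt_or_gt_of_ne hu1 with h1 | h1
  · have h1' : 0 < 1 - u := sub_pos.2 h1
    have hexp : Real.exp (-(r * x)) =
        Real.exp (-(r * (x * u))) * Real.exp (-(r * (x * (1 - u)))) := by
      rw [← Real.exp_add]; congr 1; ring
    have hpow : x ^ (a + b - 1) = x * (x ^ (a - 1) * x ^ (b - 1)) := by
      rw [← Real.rpow_add hx, mul_comm, ← Real.rpow_add_one hx.ne']
      congr 1; ring
    have := (Real.Gamma_pos_of_pos ha).ne'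
    have := (Real.Gamma_pos_of_pos hb).ne'
    have := (Real.Gamma_pos_of_pos (add_pos ha hb)).ne'
    rw [hxu, gammaPDFReal, gammaPDFReal, gammaPDFReal, betaPDFReal, if_pos (by positivity),
      if_pos (by positivity), if_pos hx.le, if_pos ⟨h0, h1⟩, Real.mul_rpow hx.le h0.le,
      Real.mul_rpow hx.le h1'.le, hexp, hpow, Real.rpow_add hr, beta]
    field_simp
  · have : x * (1 - u) < 0 := mul_neg_of_pos_of_neg hx (by linarith)
    simp [gammaPDFReal, betaPDFReal, hxu, this.not_ge, h1.not_gt]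

theorem lconvolution_gammaPDF {a b r x : ℝ} (ha : 0 < a) (hb : 0 < b) (hr : 0 < r) (hx : x ≠ 0) :
    (gammaPDF a r ⋆ₗ gammaPDF b r) x = gammaPDF (a + b) r x := by
  rw [lconvolution_def]
  rcases lt_or_gt_of_ne hx with hx | hx
  · rw [gammaPDF_of_neg hx, lintegral_eq_zero_iff (by fun_prop)]
    refine ae_of_all _ fun y => ?_
    rcases lt_or_ge y 0 with hy | hy
    · simp [gammaPDF_of_neg hy]
    · simp [gammaPDF_of_neg (show -y + x < 0 by linarith)]
  · rw [← Real.smul_map_volume_mul_left hx.ne', lintegral_smul_measure,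
      lintegral_map (by fun_prop) (by fun_prop), abs_of_pos hx, smul_eq_mul,
      ← lintegral_const_mul _ (by fun_prop)]
    calc _ = ∫⁻ u, gammaPDF (a + b) r x * betaPDF a b u := by
          refine lintegral_congr_ae ?_
          filter_upwards [Measure.ae_ne volume 0, Measure.ae_ne volume 1] with u hu0 hu1
          simp only [gammaPDF, betaPDF]
          rw [← ENNReal.ofReal_mul (gammaPDFReal_nonneg ha hr _), ← ENNReal.ofReal_mul hx.le,
            ← ENNReal.ofReal_mul (gammaPDFReal_nonneg (add_pos ha hb) hr _), neg_add_eq_sub,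
            gammaPDFReal_mul_gammaPDFReal_sub ha hb hr hx hu0 hu1]
      _ = gammaPDF (a + b) r x := by
          rw [lintegral_const_mul (f := betaPDF a b) _ (measurable_betaPDFReal a b).ennreal_ofReal,
            lintegral_betaPDF_eq_one ha hb, mul_one]

theorem gammaMeasure_conv_gammaMeasure {a b r : ℝ} (ha : 0 < a) (hb : 0 < b) (hr : 0 < r) :
    gammaMeasure a r ∗ gammaMeasure b r = gammaMeasure (a + b) r := by
  have := isProbabilityMeasure_gammaMeasure ha hr
  have := isProbabilityMeasure_gammaMeasure hb hr
  unfold gammaMeasure at *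
  rw [conv_withDensity_eq_lconvolution (by fun_prop) (by fun_prop)]
  refine withDensity_congr_ae ?_
  filter_upwards [Measure.ae_ne volume 0] with x hx
  exact lconvolution_gammaPDF ha hb hr hx

theorem ae_nonneg_gammaMeasure (a r : ℝ) : ∀ᵐ x ∂gammaMeasure a r, 0 ≤ x := by
  rw [gammaMeasure, ae_withDensity_iff (by fun_prop)]
  exact ae_of_all _ fun x hx => not_lt.1 fun h => hx (gammaPDF_of_neg h)

theorem integrable_id_gammaMeasure {a r : ℝ} (ha : 0 < a) (hr : 0 < r) :
    Integrable (fun x => x) (gammaMeasure a r) := by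
  rw [gammaMeasure, integrable_withDensity_iff (by fun_prop) (by simp [gammaPDF])]
  have hprob : Integrable (gammaPDFReal (a + 1) r) := by
    refine ⟨by fun_prop, ?_⟩
    rw [hasFiniteIntegral_iff_ofReal (ae_of_all _ (gammaPDFReal_nonneg (by positivity) hr))]
    exact (lintegral_gammaPDF_eq_one (by positivity) hr).trans_lt ENNReal.one_lt_top
  refine (hprob.const_mul (a / r)).congr (ae_of_all _ fun x => ?_)
  simp only [gammaPDF, ENNReal.toReal_ofReal (gammaPDFReal_nonneg ha hr x)]
  rcases lt_or_ge x 0 with hx | hx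
  · simp [gammaPDFReal, hx.not_ge]
  · have hpow : x ^ a = x * x ^ (a - 1) := by
      rw [← Real.rpow_one_add' hx] <;> simp [ha.ne']
    have := (Real.Gamma_pos_of_pos ha).ne'
    rw [gammaPDFReal, gammaPDFReal, if_pos hx, if_pos hx, add_sub_cancel_right, hpow,
      Real.Gamma_add_one ha.ne', Real.rpow_add_one hr.ne']
    field_simp

end ProbabilityTheory

section WeightedMax

variable {ι : Type*} [Finite ι] {c : ι → ℝ}

theorem iSup_mul_add_le [Nonempty ι] (v w : ι → ℝ) :
    ⨆ i, c i * (v i + w i) ≤ (⨆ i, c i * v i) + ⨆ i, c i * w i :=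
  ciSup_le fun i => (mul_add _ _ _).trans_le <|
    add_le_add (le_ciSup (f := fun i => c i * v i) (Set.finite_range _).bddAbove i)
      (le_ciSup (f := fun i => c i * w i) (Set.finite_range _).bddAbove i)

theorem iSup_mul_le_iSup_mul_add (hc : ∀ i, 0 ≤ c i) (v : ι → ℝ) {w : ι → ℝ}
    (hw : ∀ i, 0 ≤ w i) : ⨆ i, c i * v i ≤ ⨆ i, c i * (v i + w i) :=
  ciSup_mono (Set.finite_range _).bddAbove fun i =>
    mul_le_mul_of_nonneg_left (le_add_of_nonneg_right (hw i)) (hc i)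

end WeightedMax

theorem integrable_iSup_mul_pi_gammaMeasure {ι : Type*} [Fintype ι] [Nonempty ι] (c : ι → ℝ)
    {a r : ℝ} (ha : 0 < a) (hr : 0 < r) :
    Integrable (fun v : ι → ℝ => ⨆ i, c i * v i) (Measure.pi fun _ => gammaMeasure a r) := by
  have := isProbabilityMeasure_gammaMeasure ha hr
  have hsum : Integrable (fun v : ι → ℝ => ∑ i, |c i * v i|)
      (Measure.pi fun _ => gammaMeasure a r) :=
    integrable_finsetSum _ fun i _ => ((integrable_comp_eval (μ := fun _ : ι => gammaMeasure a r)
      (i := i) (integrable_id_gammaMeasure ha hr)).const_mul (c i)).abs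
  refine hsum.mono' (Measurable.iSup fun i => by fun_prop).aestronglyMeasurable
    (ae_of_all _ fun v => ?_)
  obtain ⟨i, hi⟩ := exists_eq_ciSup_of_finite (f := fun i => c i * v i)
  rw [← hi, Real.norm_eq_abs]
  exact Finset.single_le_sum (f := fun i => |c i * v i|) (fun _ _ => abs_nonneg _)
    (Finset.mem_univ i)

theorem mul_dirichletDNorm {d : ℕ} {α : ℝ} (hα : α ≠ 0) (x : Fin d → ℝ) :
    α * dirichletDNorm d α x =
      ∫ v : Fin d → ℝ, ⨆ i, |x i| * v i ∂(Measure.pi fun _ => gammaMeasure α 1) := by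
  rw [dirichletDNorm, ← mul_assoc, mul_one_div_cancel hα, one_mul]

/-- For `0 < α₁ < α₂`:
`α₁‖x‖_{D(α₁)} ≤ α₂‖x‖_{D(α₂)} ≤ α₁‖x‖_{D(α₁)} + (α₂−α₁)‖x‖_{D(α₂−α₁)}`. -/
theorem dirichletDNorm_sandwich (d : ℕ) (hd : 0 < d) (x : Fin d → ℝ)
    (α₁ α₂ : ℝ) (hα₁ : 0 < α₁) (h : α₁ < α₂) :
    α₁ * dirichletDNorm d α₁ x ≤ α₂ * dirichletDNorm d α₂ x ∧
      α₂ * dirichletDNorm d α₂ x ≤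
        α₁ * dirichletDNorm d α₁ x + (α₂ - α₁) * dirichletDNorm d (α₂ - α₁) x := by
  have : Nonempty (Fin d) := ⟨⟨0, hd⟩⟩
  have hβ : 0 < α₂ - α₁ := sub_pos.2 h
  have hα₂ : 0 < α₂ := hα₁.trans h
  have := isProbabilityMeasure_gammaMeasure hα₁ one_pos
  have := isProbabilityMeasure_gammaMeasure hβ one_pos
  rw [mul_dirichletDNorm hα₁.ne', mul_dirichletDNorm hα₂.ne', mul_dirichletDNorm hβ.ne']
  have hint₁ := integrable_iSup_mul_pi_gammaMeasure (fun i => |x i|) hα₁ one_pos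
  have hintβ := integrable_iSup_mul_pi_gammaMeasure (fun i => |x i|) hβ one_pos
  have hint₂ := integrable_iSup_mul_pi_gammaMeasure (fun i => |x i|) hα₂ one_pos
  have hconv : (Measure.pi fun _ : Fin d => gammaMeasure α₂ 1) =
      ((Measure.pi fun _ : Fin d => gammaMeasure α₁ 1).prod
        (Measure.pi fun _ : Fin d => gammaMeasure (α₂ - α₁) 1)).map fun p => p.1 + p.2 := by
    rw [← Measure.conv, Measure.conv_pi, gammaMeasure_conv_gammaMeasure hα₁ hβ one_pos,
      add_sub_cancel]
  rw [hconv] at hint₂ ⊢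
  rw [integral_map (by fun_prop) hint₂.aestronglyMeasurable]
  have hsum := (integrable_map_measure hint₂.aestronglyMeasurable (by fun_prop)).1 hint₂
  have hfst := hint₁.comp_fst (Measure.pi fun _ : Fin d => gammaMeasure (α₂ - α₁) 1)
  have hsnd := hintβ.comp_snd (Measure.pi fun _ : Fin d => gammaMeasure α₁ 1)
  have hfst_eq := integral_fun_fst (μ := Measure.pi fun _ : Fin d => gammaMeasure α₁ 1)
    (ν := Measure.pi fun _ : Fin d => gammaMeasure (α₂ - α₁) 1)
    (fun v : Fin d → ℝ => ⨆ i, |x i| * v i)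
  have hsnd_eq := integral_fun_snd (μ := Measure.pi fun _ : Fin d => gammaMeasure α₁ 1)
    (ν := Measure.pi fun _ : Fin d => gammaMeasure (α₂ - α₁) 1)
    (fun v : Fin d → ℝ => ⨆ i, |x i| * v i)
  rw [probReal_univ, one_smul] at hfst_eq hsnd_eq
  rw [← hfst_eq, ← hsnd_eq]
  constructor
  · refine integral_mono_ae hfst hsum ?_
    have hnonneg : ∀ᵐ w ∂(Measure.pi fun _ : Fin d => gammaMeasure (α₂ - α₁) 1), ∀ i, 0 ≤ w i :=
      ae_all_iff.2 fun i =>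
        (Measure.quasiMeasurePreserving_eval (fun _ : Fin d => gammaMeasure (α₂ - α₁) 1) i).ae
          (ae_nonneg_gammaMeasure _ _)
    filter_upwards [Measure.quasiMeasurePreserving_snd.ae hnonneg] with p hp
    exact iSup_mul_le_iSup_mul_add (fun i => abs_nonneg (x i)) p.1 hp
  · rw [← integral_add hfst hsnd]
    exact integral_mono hsum (hfst.add hsnd) fun p => iSup_mul_add_le p.1 p.2
end
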